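/- Let X be a real Hilbert space, let f₁,…,f_K ∈ X be unit vectors and c₁,…,c_K ∈ ℝ, let ℋ_r = {x ∈ X : ⟨x, f_r⟩ ≤ c_r} for r = 1,…,K, and suppose that C := ∩_{r=1}^K ℋ_r is nonempty. Let a ∈ X and define v' : X^K → ℝ ∪ {+∞} by v'(y₁,…,y_K) = ½‖a − Σ_{r=1}^K y_r‖² + Σ_{r=1}^K δ*(y_r, ℋ_r). If (y'₁,…,y'_K) is a minimizer of v' over X^K, then Σ_{r=1}^K y'_r = a − P_C(a); equivalently, Σ_{r=1}^K y'_r is the unique minimizer of e ↦ ½‖a − e‖² + δ*(e, C). (Proposition 6.4: dual problem obtained by breaking up a polyhedron into its defining halfspaces.) -/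

import Mathlib

open scoped RealInnerProductSpace

/-- The support function `δ*(z, D) = sup_{x ∈ D} ⟪z, x⟫`, with values in `EReal`. -/
noncomputable def suppFn {X : Type*} [NormedAddCommGroup X] [InnerProductSpace ℝ X]
    (z : X) (D : Set X) : EReal :=
  ⨆ x ∈ D, ((⟪z, x⟫ : ℝ) : EReal)

section Halfspace

variable {X : Type*} [NormedAddCommGroup X] [InnerProductSpace ℝ X]

theorem le_suppFn {D : Set X} {x : X} (hx : x ∈ D) (z : X) :
    ((⟪z, x⟫ : ℝ) : EReal) ≤ suppFn z D :=
  le_iSup₂ (f := fun x (_ : x ∈ D) => ((⟪z, x⟫ : ℝ) : EReal)) x hx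

theorem suppFn_smul_halfspace {f : X} (hf : ‖f‖ = 1) (c : ℝ) {t : ℝ} (ht : 0 ≤ t) :
    suppFn (t • f) {x : X | ⟪x, f⟫ ≤ c} = ((t * c : ℝ) : EReal) := by
  apply le_antisymm
  · refine iSup₂_le fun x hx => ?_
    rw [EReal.coe_le_coe_iff, real_inner_smul_left, real_inner_comm]
    exact mul_le_mul_of_nonneg_left hx ht
  · have hmem : c • f ∈ {x : X | ⟪x, f⟫ ≤ c} := by
      simp [real_inner_smul_left, hf]
    simpa [real_inner_smul_left, real_inner_smul_right, hf, mul_comm] using le_suppFn hmem (t • f)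

/-- Where the support function of a set is finite, it is nonpositive on recession directions. -/
theorem inner_nonpos_of_suppFn_ne_top {D : Set X} {z x d : X} (hz : suppFn z D ≠ ⊤)
    (hd : ∀ s : ℝ, 0 ≤ s → x + s • d ∈ D) : ⟪z, d⟫ ≤ 0 := by
  by_contra! h
  have hbot : suppFn z D ≠ ⊥ :=
    ne_bot_of_le_ne_bot (EReal.coe_ne_bot _) (le_suppFn (hd 0 le_rfl) z)
  have hb : ∀ s : ℝ, 0 ≤ s → ⟪z, x⟫ + s * ⟪z, d⟫ ≤ (suppFn z D).toReal := fun s hs => by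
    have := le_suppFn (hd s hs) z
    rwa [← EReal.coe_toReal hz hbot, EReal.coe_le_coe_iff, inner_add_right,
      real_inner_smul_right] at this
  have h0 := hb 0 le_rfl
  have h1 := hb (((suppFn z D).toReal - ⟪z, x⟫ + 1) / ⟪z, d⟫)
    (div_nonneg (by linarith) h.le)
  rw [div_mul_cancel₀ _ h.ne'] at h1
  linarith

theorem exists_nonneg_smul_of_suppFn_halfspace_ne_top {f : X} (hf : ‖f‖ = 1) {c : ℝ} {z : X}
    (hz : suppFn z {x : X | ⟪x, f⟫ ≤ c} ≠ ⊤) : ∃ t : ℝ, 0 ≤ t ∧ z = t • f := by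
  have key : ∀ d : X, ⟪d, f⟫ ≤ 0 → ⟪z, d⟫ ≤ 0 := fun d hd =>
    inner_nonpos_of_suppFn_ne_top (x := c • f) hz fun s hs => by
      have := mul_nonpos_of_nonneg_of_nonpos hs hd
      simpa [inner_add_left, real_inner_smul_left, hf] using this
  refine ⟨⟪z, f⟫, ?_, ?_⟩
  · simpa [hf] using key (-f)
  · have horth : ⟪z - ⟪z, f⟫ • f, f⟫ = 0 := by
      simp [inner_sub_left, real_inner_smul_left, hf]
    have h := key (z - ⟪z, f⟫ • f) horth.le
    have hself : ⟪z - ⟪z, f⟫ • f, z - ⟪z, f⟫ • f⟫ = ⟪z, z - ⟪z, f⟫ • f⟫ := by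
      rw [inner_sub_left z, real_inner_smul_left, real_inner_comm _ f, horth]
      simp
    rw [← hself] at h
    exact sub_eq_zero.mp (inner_self_eq_zero.mp (le_antisymm h real_inner_self_nonneg))

theorem EReal.coe_sum_of_real {ι : Type*} (s : Finset ι) (g : ι → ℝ) :
    ((∑ i ∈ s, g i : ℝ) : EReal) = ∑ i ∈ s, (g i : EReal) :=
  map_sum (⟨⟨Real.toEReal, EReal.coe_zero⟩, EReal.coe_add⟩ : ℝ →+ EReal) g s

/-- A point satisfying the variational inequality is the only nearest point. -/
theorem eq_of_inner_sub_nonpos_of_norm_sub_le {a p q : X} (h : ⟪a - q, p - q⟫ ≤ 0)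
    (hle : ‖a - p‖ ≤ ‖a - q‖) : p = q := by
  have hexp := norm_sub_sq_real (a - q) (p - q)
  rw [sub_sub_sub_cancel_right] at hexp
  have hsq : ‖a - p‖ ^ 2 ≤ ‖a - q‖ ^ 2 := by gcongr
  have h0 : ‖p - q‖ ^ 2 = 0 := le_antisymm (by linarith) (sq_nonneg _)
  exact sub_eq_zero.mp (norm_eq_zero.mp (pow_eq_zero_iff two_ne_zero |>.mp h0))

/-- First-order conditions for minimizing `s ↦ s * g + s ^ 2 / 2` at `0` over `s ≥ -t`. -/
theorem nonneg_and_mul_eq_zero_of_quadratic_nonneg {t g : ℝ} (ht : 0 ≤ t)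
    (h : ∀ s : ℝ, 0 ≤ t + s → 0 ≤ s * g + s ^ 2 / 2) : 0 ≤ g ∧ t * g = 0 := by
  have hg : 0 ≤ g := by
    by_contra! hg
    nlinarith [h (-g) (by linarith), mul_pos_of_neg_of_neg hg hg]
  refine ⟨hg, ?_⟩
  by_contra! hne
  have hm : 0 < min g t :=
    lt_min (hg.lt_of_ne' (right_ne_zero_of_mul hne)) (ht.lt_of_ne' (left_ne_zero_of_mul hne))
  have h1 := h (-min g t) (by linarith [min_le_right g t])
  nlinarith [mul_le_mul_of_nonneg_left (min_le_left g t) hm.le, mul_pos hm hm]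

end Halfspace

/-- Proposition 6.4: breaking up the polyhedron `C = ∩_r ℋ_r` into its defining
halfspaces `ℋ_r = {x : ⟪x, f r⟫ ≤ c r}`. If `(y'₁, …, y'_K)` minimizes
`v'(y) = ½‖a − ∑ r y r‖² + ∑ r δ*(y r, ℋ_r)`, then `∑ r y' r = a − P_C(a)`.
Here `p` is characterized as the metric projection `P_C(a)`. -/
theorem dual_minimizer_breakup {X : Type*} [NormedAddCommGroup X]
    [InnerProductSpace ℝ X] [CompleteSpace X] {K : ℕ}
    (f : Fin K → X) (hf : ∀ r, ‖f r‖ = 1) (c : Fin K → ℝ)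
    (hCne : (⋂ r, {x : X | ⟪x, f r⟫ ≤ c r}).Nonempty)
    (a p : X) (hp : p ∈ ⋂ r, {x : X | ⟪x, f r⟫ ≤ c r})
    (hpn : ∀ x ∈ ⋂ r, {x : X | ⟪x, f r⟫ ≤ c r}, ‖a - p‖ ≤ ‖a - x‖)
    (y' : Fin K → X)
    (hmin : ∀ y : Fin K → X,
      ((1 / 2 * ‖a - ∑ r, y' r‖ ^ 2 : ℝ) : EReal) +
          ∑ r, suppFn (y' r) {x : X | ⟪x, f r⟫ ≤ c r} ≤
        ((1 / 2 * ‖a - ∑ r, y r‖ ^ 2 : ℝ) : EReal) +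
          ∑ r, suppFn (y r) {x : X | ⟪x, f r⟫ ≤ c r}) :
    ∑ r, y' r = a - p := by
  have hfin : ∀ r, suppFn (y' r) {x : X | ⟪x, f r⟫ ≤ c r} ≠ ⊤ := by
    intro r htop
    obtain ⟨x₀, hx₀⟩ := hCne
    rw [Set.mem_iInter] at hx₀
    have hrest : ((∑ i ∈ Finset.univ.erase r, ⟪y' i, x₀⟫ : ℝ) : EReal) ≤
        ∑ i ∈ Finset.univ.erase r, suppFn (y' i) {x : X | ⟪x, f i⟫ ≤ c i} := by
      rw [EReal.coe_sum_of_real]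
      exact Finset.sum_le_sum fun i _ => le_suppFn (hx₀ i) _
    have hzero : ∀ i, suppFn (0 : X) {x : X | ⟪x, f i⟫ ≤ c i} = 0 := fun i => by
      simpa using suppFn_smul_halfspace (hf i) (c i) le_rfl
    have h := hmin 0
    rw [← Finset.add_sum_erase _ (fun i => suppFn (y' i) {x : X | ⟪x, f i⟫ ≤ c i})
      (Finset.mem_univ r), htop,
      EReal.top_add_of_ne_bot (ne_bot_of_le_ne_bot (EReal.coe_ne_bot _) hrest),
      EReal.coe_add_top] at h
    simp only [Pi.zero_apply, hzero, Finset.sum_const_zero, add_zero, top_le_iff] at h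
    exact EReal.coe_ne_top _ h
  choose t ht hyt using fun r => exists_nonneg_smul_of_suppFn_halfspace_ne_top (hf r) (hfin r)
  have hval : ∀ u : Fin K → ℝ, (∀ r, 0 ≤ u r) →
      ∑ r, suppFn (u r • f r) {x : X | ⟪x, f r⟫ ≤ c r} = ((∑ r, u r * c r : ℝ) : EReal) :=
    fun u hu => by
      rw [EReal.coe_sum_of_real]
      exact Finset.sum_congr rfl fun r _ => suppFn_smul_halfspace (hf r) (c r) (hu r)
  obtain rfl : y' = fun r => t r • f r := funext hyt
  have hreal : ∀ u : Fin K → ℝ, (∀ r, 0 ≤ u r) →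
      1 / 2 * ‖a - ∑ r, t r • f r‖ ^ 2 + ∑ r, t r * c r ≤
        1 / 2 * ‖a - ∑ r, u r • f r‖ ^ 2 + ∑ r, u r * c r := fun u hu => by
    have h := hmin fun r => u r • f r
    rwa [hval t ht, hval u hu, ← EReal.coe_add, ← EReal.coe_add, EReal.coe_le_coe_iff] at h
  set q := a - ∑ r, t r • f r with hq
  have hkkt : ∀ r, 0 ≤ c r - ⟪q, f r⟫ ∧ t r * (c r - ⟪q, f r⟫) = 0 := fun r => by
    refine nonneg_and_mul_eq_zero_of_quadratic_nonneg (ht r) fun s hs => ?_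
    have h := hreal (t + Pi.single r s) fun i => by
      by_cases hi : i = r
      · subst hi; simpa using hs
      · simpa [hi] using ht i
    have hvec : a - ∑ i, (t + Pi.single r s : Fin K → ℝ) i • f i = q - s • f r := by
      simp [hq, add_smul, Finset.sum_add_distrib, Pi.single_apply, ite_smul, sub_sub]
    have hlin : ∑ i, (t + Pi.single r s : Fin K → ℝ) i * c i = ∑ i, t i * c i + s * c r := by
      simp [add_mul, Finset.sum_add_distrib, Pi.single_apply]
    rw [hvec, hlin, norm_sub_sq_real q, real_inner_smul_right, norm_smul, hf r, mul_one,
      Real.norm_eq_abs, sq_abs] at h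
    linarith
  have hqC : q ∈ ⋂ r, {x : X | ⟪x, f r⟫ ≤ c r} :=
    Set.mem_iInter.mpr fun r => sub_nonneg.mp (hkkt r).1
  have hvar : ⟪a - q, p - q⟫ ≤ 0 := by
    rw [hq, sub_sub_cancel, ← hq, sum_inner]
    refine Finset.sum_nonpos fun r _ => ?_
    have hpr : ⟪p, f r⟫ ≤ c r := Set.mem_iInter.mp hp r
    rw [real_inner_smul_left, real_inner_comm, inner_sub_left]
    nlinarith [mul_le_mul_of_nonneg_left hpr (ht r), (hkkt r).2]
  rw [eq_of_inner_sub_nonpos_of_norm_sub_le hvar (hpn q hqC), hq, sub_sub_cancel]
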